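/- Let A, B ⊆ ℤ be nonempty sets. Then there exists a positive integer k, depending only on A and B, with the following property: for every Følner sequence F = (F_n)_{n∈ℕ} in ℤ such that δ := d̲_F(A) + d̲_F(B) − d̲_F(A+B) > 0, there exist a strictly increasing sequence of indices (n_j)_{j∈ℕ} and finite sets Ψ_j ⊆ F_{n_j} such that Ψ = (Ψ_j)_{j∈ℕ} is a Følner sequence in ℤ satisfying: (1) liminf_{j→∞} |Ψ_j|/|F_{n_j}| ≥ kδ; (2) the densities d_Ψ(A+B) and d_Ψ(A+B+kℤ) both exist and are equal; (3) the densities d_Ψ(A), d_Ψ(B) and d_Ψ(A+B) all exist and d_Ψ(A) + d_Ψ(B) − d_Ψ(A+B) ≥ δ. -/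

import Mathlib

open scoped Pointwise
open Filter

namespace SumsetMeans

/-- The density of `C` in the finite set `F n`, i.e. `|C ∩ F n| / |F n|`. -/
noncomputable def dens (F : ℕ → Finset ℤ) (C : Set ℤ) (n : ℕ) : ℝ :=
  ((C ∩ (F n : Set ℤ)).ncard : ℝ) / ((F n).card : ℝ)

/-- A Følner sequence in `ℤ`: nonempty finite sets that are asymptotically invariant
under every translation. -/
def IsFolnerSeq (F : ℕ → Finset ℤ) : Prop :=
  (∀ n, (F n).Nonempty) ∧
  ∀ t : ℤ, Tendsto (fun n =>
      ((symmDiff ((F n : Set ℤ)) ((F n : Set ℤ) + ({t} : Set ℤ))).ncard : ℝ) / ((F n).card : ℝ))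
    atTop (nhds 0)

/-- The translate `S + t`. -/
def tr (t : ℤ) (S : Set ℤ) : Set ℤ := {x | x - t ∈ S}

@[simp] lemma mem_tr {t x : ℤ} {S : Set ℤ} : x ∈ tr t S ↔ x - t ∈ S := Iff.rfl

lemma tr_tr (s t : ℤ) (S : Set ℤ) : tr s (tr t S) = tr (t + s) S := by
  ext x; simp only [mem_tr]; rw [show x - s - t = x - (t + s) by ring]

@[simp] lemma tr_zero (S : Set ℤ) : tr 0 S = S := by ext x; simp

/-- A finitely additive, translation invariant, finite measure on the subsets of `ℤ`. -/
structure IsInv (m : Set ℤ → ℝ) : Prop where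
  nonneg : ∀ S, 0 ≤ m S
  union : ∀ S T, Disjoint S T → m (S ∪ T) = m S + m T
  shift : ∀ t S, m (tr t S) = m S

namespace IsInv

variable {m : Set ℤ → ℝ}

lemma of_shift_one (h0 : ∀ S, 0 ≤ m S) (h1 : ∀ S T, Disjoint S T → m (S ∪ T) = m S + m T)
    (h2 : ∀ S, m (tr 1 S) = m S) : IsInv m := by
  refine ⟨h0, h1, fun t => ?_⟩
  induction t using Int.induction_on with
  | zero => intro S; simp
  | succ n ih => intro S; rw [← tr_tr, h2, ih]
  | pred n ih => intro S; rw [← h2, tr_tr, sub_add_cancel, ih]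

lemma empty (h : IsInv m) : m ∅ = 0 := by
  have := h.union ∅ ∅ (by simp)
  simp at this; linarith

lemma inter_diff (h : IsInv m) (S T : Set ℤ) : m S = m (S ∩ T) + m (S \ T) := by
  rw [← h.union _ _ (Set.disjoint_sdiff_inter.symm), Set.inter_union_sdiff]

lemma mono (h : IsInv m) {S T : Set ℤ} (hST : S ⊆ T) : m S ≤ m T := by
  have := h.inter_diff T S
  rw [Set.inter_eq_self_of_subset_right hST] at this
  have := h.nonneg (T \ S)
  linarith

lemma diff_of_subset (h : IsInv m) {S T : Set ℤ} (hST : S ⊆ T) : m (T \ S) = m T - m S := by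
  have := h.inter_diff T S
  rw [Set.inter_eq_self_of_subset_right hST] at this
  linarith

lemma union_le (h : IsInv m) (S T : Set ℤ) : m (S ∪ T) ≤ m S + m T := by
  have := h.union S (T \ S) Set.disjoint_sdiff_right
  rw [Set.union_sdiff_self] at this
  have := h.mono (Set.sdiff_subset : T \ S ⊆ T)
  linarith

lemma union_inter (h : IsInv m) (S T : Set ℤ) : m (S ∪ T) + m (S ∩ T) = m S + m T := by
  have h1 := h.union S (T \ S) Set.disjoint_sdiff_right
  rw [Set.union_sdiff_self] at h1
  have h2 := h.inter_diff T S
  rw [Set.inter_comm] at h2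
  linarith

lemma biUnion {ι : Type*} (h : IsInv m) (s : Finset ι) (T : ι → Set ℤ)
    (hd : ∀ i ∈ s, ∀ j ∈ s, i ≠ j → Disjoint (T i) (T j)) :
    m (⋃ i ∈ s, T i) = ∑ i ∈ s, m (T i) := by
  classical
  induction s using Finset.induction_on with
  | empty => simp [h.empty]
  | insert a s ha ih =>
    rw [Finset.set_biUnion_insert, h.union, Finset.sum_insert ha, ih]
    · exact fun i hi j hj => hd i (Finset.mem_insert_of_mem hi) j (Finset.mem_insert_of_mem hj)
    · rw [Set.disjoint_iUnion₂_right]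
      intro i hi
      exact hd a (Finset.mem_insert_self _ _) i (Finset.mem_insert_of_mem hi)
        (by rintro rfl; exact ha hi)

lemma biUnion_le {ι : Type*} (h : IsInv m) (s : Finset ι) (T : ι → Set ℤ) :
    m (⋃ i ∈ s, T i) ≤ ∑ i ∈ s, m (T i) := by
  classical
  induction s using Finset.induction_on with
  | empty => simp [h.empty]
  | insert a s ha ih =>
    rw [Finset.set_biUnion_insert, Finset.sum_insert ha]
    exact (h.union_le _ _).trans (by linarith)

/-- Pairwise disjoint translates of `B` cannot have total mass more than the whole space. -/
lemma packing {ι : Type*} (h : IsInv m) (s : Finset ι) (t : ι → ℤ) (B : Set ℤ)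
    (hd : ∀ i ∈ s, ∀ j ∈ s, i ≠ j → Disjoint (tr (t i) B) (tr (t j) B)) :
    (s.card : ℝ) * m B ≤ m Set.univ := by
  have h1 := h.biUnion s (fun i => tr (t i) B) hd
  simp only [h.shift, Finset.sum_const, nsmul_eq_mul] at h1
  rw [← h1]
  exact h.mono (Set.subset_univ _)

/-- Monotonicity of the integral of simple functions. -/
lemma sum_le {ι : Type*} (h : IsInv m) (s : Finset ι) (c : ι → ℝ) (T : ι → Set ℤ) :
    ∀ (X : Set ℤ) (κ : ℝ), (∀ x ∈ X, ∑ i ∈ s, c i * (T i).indicator 1 x ≤ κ) →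
      ∑ i ∈ s, c i * m (T i ∩ X) ≤ κ * m X := by
  classical
  induction s using Finset.induction_on with
  | empty =>
    intro X κ hX
    rcases X.eq_empty_or_nonempty with rfl | ⟨x, hx⟩
    · simp [h.empty]
    · have := hX x hx
      simp only [Finset.sum_empty] at this ⊢
      exact mul_nonneg this (h.nonneg _)
  | insert a s ha ih =>
    intro X κ hX
    simp only [Finset.sum_insert ha] at hX ⊢
    have h1 := ih (X ∩ T a) (κ - c a) (fun x hx => by
      have := hX x hx.1
      rw [Set.indicator_of_mem hx.2] at this
      simp only [Pi.one_apply] at this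
      linarith)
    have h2 := ih (X \ T a) κ (fun x hx => by
      have := hX x hx.1
      rw [Set.indicator_of_notMem hx.2] at this
      linarith)
    have h3 : ∑ i ∈ s, c i * m (T i ∩ X)
        = ∑ i ∈ s, c i * m (T i ∩ (X ∩ T a)) + ∑ i ∈ s, c i * m (T i ∩ (X \ T a)) := by
      rw [← Finset.sum_add_distrib]
      refine Finset.sum_congr rfl fun i _ => ?_
      rw [h.inter_diff (T i ∩ X) (T a), Set.inter_assoc, Set.inter_sdiff_assoc, mul_add]
    have h4 := h.inter_diff X (T a)
    rw [h3, h4, Set.inter_comm (T a) X]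
    linarith

end IsInv

/-- The preimage in `ℤ` of a set of residues. -/
def lift {K : ℕ} (S : Set (ZMod K)) : Set ℤ := {x | (x : ZMod K) ∈ S}

@[simp] lemma mem_lift {K : ℕ} {S : Set (ZMod K)} {x : ℤ} :
    x ∈ lift S ↔ (x : ZMod K) ∈ S := Iff.rfl

lemma IsInv.lift_singleton {m : Set ℤ → ℝ} (h : IsInv m) {K : ℕ} [NeZero K] (r : ZMod K) :
    m (lift {r}) = m Set.univ / K := by
  have h1 : ∀ r : ZMod K, m (lift {r}) = m (lift ({0} : Set (ZMod K))) := by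
    intro r
    obtain ⟨t, rfl⟩ := ZMod.intCast_surjective r
    rw [← h.shift t (lift {0})]
    congr 1
    ext x
    simp [sub_eq_zero]
  have h2 := h.biUnion (Finset.univ : Finset (ZMod K)) (fun r => lift {r}) (by
    intro i _ j _ hij
    rw [Set.disjoint_left]
    intro x hx hx'
    simp only [mem_lift, Set.mem_singleton_iff] at hx hx'
    exact hij (hx.symm.trans hx'))
  have h3 : (⋃ r ∈ (Finset.univ : Finset (ZMod K)), lift {r}) = Set.univ := by
    ext x; simp
  rw [h3] at h2
  simp only [h1, Finset.sum_const, Finset.card_univ, ZMod.card, nsmul_eq_mul] at h2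
  rw [h1, h2]
  have : (K : ℝ) ≠ 0 := by exact_mod_cast NeZero.ne K
  field_simp

lemma IsInv.lift_eq {m : Set ℤ → ℝ} (h : IsInv m) {K : ℕ} [NeZero K] (S : Set (ZMod K)) :
    m (lift S) = S.ncard * m Set.univ / K := by
  classical
  have h2 := h.biUnion S.toFinset (fun r => lift {r}) (by
    intro i _ j _ hij
    rw [Set.disjoint_left]
    intro x hx hx'
    simp only [mem_lift, Set.mem_singleton_iff] at hx hx'
    exact hij (hx.symm.trans hx'))
  have h3 : (⋃ r ∈ S.toFinset, lift {r}) = lift S := by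
    ext x; simp
  rw [h3] at h2
  rw [h2]
  simp only [h.lift_singleton, Finset.sum_const, nsmul_eq_mul, Set.ncard_eq_toFinset_card']
  ring

/-- An invariant probability mean all of whose invariant minorants are multiples of it. -/
structure IsErg (m : Set ℤ → ℝ) : Prop extends IsInv m where
  univ : m Set.univ = 1
  minorant : ∀ ν, IsInv ν → (∀ S, ν S ≤ m S) → ∀ S, ν S = ν Set.univ * m S

lemma exists_ultrafilter_limit {α : Type*} (U : Ultrafilter ℕ) (g : ℕ → α → ℝ)
    (hg : ∀ n a, g n a ∈ Set.Icc (0 : ℝ) 1) :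
    ∃ ν : α → ℝ, ∀ a, Tendsto (fun n => g n a) U (nhds (ν a)) := by
  have : ∀ a, ∃ x, Tendsto (fun n => g n a) U (nhds x) := by
    intro a
    obtain ⟨x, -, hx⟩ := (isCompact_Icc (a := (0 : ℝ)) (b := 1)).ultrafilter_le_nhds
      (U.map fun n => g n a) (by
        rw [Filter.le_principal_iff]
        exact Filter.mem_map.2 (Filter.Eventually.of_forall fun n => hg n a))
    exact ⟨x, hx⟩
  choose ν hν using this
  exact ⟨ν, hν⟩

lemma tendsto_inv_hyperfilter (c : ℝ) :
    Tendsto (fun n : ℕ => c / ((n : ℝ) + 1)) (hyperfilter ℕ : Ultrafilter ℕ) (nhds 0) := by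
  have := (tendsto_one_div_add_atTop_nhds_zero_nat (𝕜 := ℝ)).const_mul c
  simp only [mul_one_div, mul_zero] at this
  exact this.mono_left Nat.hyperfilter_le_atTop

/-- The mean ergodic theorem along arbitrary windows of growing length. -/
lemma IsErg.tendsto_average {m : Set ℤ → ℝ} (h : IsErg m) (E B : Set ℤ) (i : ℕ → ℤ) :
    Tendsto (fun n : ℕ => (∑ j ∈ Finset.range (n + 1), m (E ∩ tr (i n + j) B)) / ((n : ℝ) + 1))
      (hyperfilter ℕ : Ultrafilter ℕ) (nhds (m E * m B)) := by
  set g : ℕ → Set ℤ → ℝ := fun n S =>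
    (∑ j ∈ Finset.range (n + 1), m (S ∩ tr (i n + j) B)) / ((n : ℝ) + 1) with hg
  have hpos : ∀ n : ℕ, (0 : ℝ) < (n : ℝ) + 1 := fun n => by positivity
  have hle : ∀ n S, g n S ≤ m S := by
    intro n S
    rw [hg, div_le_iff₀ (hpos n)]
    calc ∑ j ∈ Finset.range (n + 1), m (S ∩ tr (i n + j) B)
        ≤ ∑ j ∈ Finset.range (n + 1), m S :=
          Finset.sum_le_sum fun j _ => h.mono Set.inter_subset_left
      _ = m S * ((n : ℝ) + 1) := by simp [mul_comm]
  have h0 : ∀ n S, 0 ≤ g n S := fun n S =>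
    div_nonneg (Finset.sum_nonneg fun j _ => h.nonneg _) (hpos n).le
  have hm1 : ∀ S, m S ≤ 1 := fun S => h.univ ▸ h.mono (Set.subset_univ S)
  obtain ⟨ν, hν⟩ := exists_ultrafilter_limit (hyperfilter ℕ : Ultrafilter ℕ) g
    (fun n S => ⟨h0 n S, (hle n S).trans (hm1 S)⟩)
  have hinv : IsInv ν := by
    refine IsInv.of_shift_one (fun S => ge_of_tendsto' (hν S) fun n => h0 n S) ?_ ?_
    · intro S T hST
      refine tendsto_nhds_unique (hν _) (((hν S).add (hν T)).congr fun n => ?_)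
      simp only [hg]
      rw [← add_div, ← Finset.sum_add_distrib]
      congr 1
      refine Finset.sum_congr rfl fun j _ => ?_
      rw [Set.union_inter_distrib_right, h.union]
      exact hST.mono Set.inter_subset_left Set.inter_subset_left
    · intro S
      have hd : Tendsto (fun n => g n (tr 1 S) - g n S) (hyperfilter ℕ : Ultrafilter ℕ)
          (nhds 0) := by
        refine squeeze_zero_norm (fun n => ?_) (tendsto_inv_hyperfilter 1)
        have h1 : ∀ t : ℤ, m (tr 1 S ∩ tr t B) = m (S ∩ tr (t - 1) B) := by
          intro t
          rw [← h.shift 1 (S ∩ tr (t - 1) B)]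
          congr 1
          ext x
          simp only [Set.mem_inter_iff, mem_tr]
          rw [show x - 1 - (t - 1) = x - t by ring]
        simp only [hg, h1]
        rw [← sub_div, norm_div, Real.norm_of_nonneg (hpos n).le]
        gcongr
        rw [Finset.sum_range_succ', Finset.sum_range_succ]
        have h2 : ∀ k : ℕ, i n + ((k + 1 : ℕ) : ℤ) - 1 = i n + k := by intro k; push_cast; ring
        simp only [h2]
        rw [add_sub_add_left_eq_sub, Real.norm_eq_abs, abs_le]
        have a1 := h.nonneg (S ∩ tr (i n + ((0 : ℕ) : ℤ) - 1) B)
        have a2 := h.nonneg (S ∩ tr (i n + (n : ℤ)) B)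
        have a3 := hm1 (S ∩ tr (i n + ((0 : ℕ) : ℤ) - 1) B)
        have a4 := hm1 (S ∩ tr (i n + (n : ℤ)) B)
        constructor <;> linarith
      have := tendsto_nhds_unique hd ((hν (tr 1 S)).sub (hν S))
      linarith
  have huniv : ν Set.univ = m B := by
    refine tendsto_nhds_unique (hν _) (tendsto_const_nhds.congr fun n => ?_)
    simp only [hg, Set.univ_inter, h.shift, Finset.sum_const, Finset.card_range, nsmul_eq_mul]
    have := (hpos n).ne'
    push_cast
    field_simp
  have := h.minorant ν hinv (fun S => le_of_tendsto' (hν S) fun n => hle n S) E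
  rw [huniv, mul_comm] at this
  rw [← this]
  exact hν E

lemma IsInv.exists_window {m : Set ℤ → ℝ} (h : IsInv m) (h1 : m Set.univ = 1) (S T : Set ℤ)
    (c d : ℝ) (M : ℕ) :
    ∃ i : ℤ, M * (c * m S + d * m T) - 1 ≤
      ∑ j ∈ Finset.range M, (c * S.indicator 1 (i + j) + d * T.indicator 1 (i + j)) := by
  by_contra! hcon
  have key := h.sum_le (Finset.range M ×ˢ (Finset.univ : Finset Bool))
    (fun p => if p.2 then c else d) (fun p => tr (-(p.1 : ℤ)) (if p.2 then S else T)) Set.univ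
    (M * (c * m S + d * m T) - 1) (fun x _ => by
      refine le_trans (le_of_eq ?_) (hcon x).le
      rw [Finset.sum_product]
      refine Finset.sum_congr rfl fun j _ => ?_
      simp only [Fintype.sum_bool, if_true, Bool.false_eq_true, if_false]
      classical
      simp only [Set.indicator_apply, mem_tr, sub_neg_eq_add, Pi.one_apply])
  rw [Finset.sum_product] at key
  simp only [Fintype.sum_bool, if_true, Bool.false_eq_true, if_false, Set.inter_univ, h.shift, h1,
    Finset.sum_const, Finset.card_range, nsmul_eq_mul] at key
  linarith

/-- If the correlation `t ↦ m (A ∩ (B + t))` dominates a simple function, then the integral of the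
latter is at most `m A * m B`. -/
lemma IsErg.correlation_le {m : Set ℤ → ℝ} (h : IsErg m) (A B S T : Set ℤ) (c d : ℝ)
    (hcd : ∀ t : ℤ, c * S.indicator 1 t + d * T.indicator 1 t ≤ m (A ∩ tr t B)) :
    c * m S + d * m T ≤ m A * m B := by
  choose i hi using fun n : ℕ => h.exists_window h.univ S T c d (n + 1)
  have h1 := (h.tendsto_average A B i).add (tendsto_inv_hyperfilter 1)
  rw [add_zero] at h1
  refine ge_of_tendsto' h1 fun n => ?_
  rw [← add_div, le_div_iff₀ (by positivity)]
  have h2 := (hi n).trans (Finset.sum_le_sum fun j _ => hcd (i n + j))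
  push_cast at h2
  linarith

lemma IsErg.mul_le {m : Set ℤ → ℝ} (h : IsErg m) (A B : Set ℤ) (κ : ℝ)
    (hκ : ∀ t, m (A ∩ tr t B) ≤ κ) : m A * m B ≤ κ := by
  refine le_of_tendsto' (h.tendsto_average A B 0) fun n => ?_
  rw [div_le_iff₀ (by positivity)]
  calc _ ≤ ∑ j ∈ Finset.range (n + 1), κ := Finset.sum_le_sum fun j _ => hκ _
    _ = _ := by simp [mul_comm]

lemma union_real_ineq {h M₁ M₂ u x : ℝ} (hh : 0 < h) (hu : h ≤ u) (hu' : u + h ≤ M₂)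
    (hx : h ≤ x) (h1 : x * u < h * (M₁ - h)) (h2 : (M₂ - u) * (M₁ - x) < h * (M₂ - h)) :
    False := by
  have h3 : u < M₁ - x := by
    by_contra! hc
    nlinarith [mul_nonneg (sub_nonneg.2 hx) (sub_nonneg.2 hu)]
  nlinarith [mul_nonneg (sub_nonneg.2 hu) (sub_nonneg.2 hu'),
    mul_pos (show (0 : ℝ) < M₂ - u by linarith) (sub_pos.2 h3)]

section Finite

open Classical

variable {G : Type*} [AddCommGroup G]

/-- `C` is a union of cosets of `H`. -/
def IsPer (C : Finset G) (H : AddSubgroup G) : Prop := ∀ x ∈ C, ∀ h ∈ H, x + h ∈ C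

lemma IsPer.add_mem_iff {C : Finset G} {H : AddSubgroup G} (hC : IsPer C H) {x h : G}
    (hh : h ∈ H) : x + h ∈ C ↔ x ∈ C :=
  ⟨fun hx => by simpa using hC _ hx (-h) (H.neg_mem hh), fun hx => hC _ hx _ hh⟩

variable [Fintype G]

lemma card_mul_card_le (H₁ H₂ : AddSubgroup G) (X Y D : Finset G) (p : G)
    (hX : ∀ x ∈ X, x ∈ H₁) (hY : ∀ y ∈ Y, y ∈ H₂) (hD : ∀ x ∈ X, ∀ y ∈ Y, p + x + y ∈ D) :
    X.card * Y.card ≤ Nat.card (H₁ ⊓ H₂ : AddSubgroup G) * D.card := by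
  rw [← Finset.card_product]
  refine (Finset.card_le_mul_card_image (f := fun q : G × G => p + q.1 + q.2) (X ×ˢ Y)
    (Nat.card (H₁ ⊓ H₂ : AddSubgroup G)) ?_).trans ?_
  · intro a ha
    obtain ⟨q, hq, rfl⟩ := Finset.mem_image.1 ha
    rw [Finset.mem_product] at hq
    rw [Nat.card_eq_fintype_card, Fintype.card_subtype]
    refine Finset.card_le_card_of_injOn (fun r => r.1 - q.1) ?_ ?_
    · intro r hr
      simp only [Finset.coe_filter, Finset.mem_product, Set.mem_ofPred_eq] at hr
      simp only [Finset.coe_filter, Finset.mem_univ, true_and, Set.mem_ofPred_eq]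
      refine AddSubgroup.mem_inf.2 ⟨H₁.sub_mem (hX _ hr.1.1) (hX _ hq.1), ?_⟩
      have : r.1 - q.1 = q.2 - r.2 := by
        have := hr.2
        rw [add_assoc, add_assoc, add_right_inj] at this
        rw [sub_eq_sub_iff_add_eq_add, this, add_comm]
      rw [this]
      exact H₂.sub_mem (hY _ hq.2) (hY _ hr.1.2)
    · intro r hr s hs hrs
      simp only [Finset.coe_filter, Finset.mem_product, Set.mem_ofPred_eq] at hr hs
      have e1 : r.1 = s.1 := by simpa using hrs
      have e2 := hr.2.trans hs.2.symm
      rw [e1] at e2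
      exact Prod.ext e1 (by simpa using e2)
  · refine Nat.mul_le_mul_left _ (Finset.card_le_card ?_)
    intro a ha
    obtain ⟨q, hq, rfl⟩ := Finset.mem_image.1 ha
    rw [Finset.mem_product] at hq
    exact hD _ hq.1 _ hq.2

lemma card_inf_le_of_coset (H₁ H₂ : AddSubgroup G) (X : Finset G) (a : G)
    (hX : ∀ h ∈ H₁ ⊓ H₂, a + h ∈ X) : Nat.card (H₁ ⊓ H₂ : AddSubgroup G) ≤ X.card := by
  rw [Nat.card_eq_fintype_card, Fintype.card_subtype]
  refine Finset.card_le_card_of_injOn (fun r => a + r) ?_ ?_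
  · intro r hr
    simp only [Finset.coe_filter, Finset.mem_univ, true_and, Set.mem_ofPred_eq] at hr
    exact hX r hr
  · intro r _ s _ hrs
    simpa using hrs

lemma card_sdiff_trichotomy {C₁ C₂ : Finset G} {H₁ H₂ : AddSubgroup G} (h₁ : IsPer C₁ H₁)
    (h₂ : IsPer C₂ H₂) (hne : (C₂ \ C₁).Nonempty) :
    ((Nat.card H₁ : ℝ) ≤ (C₂ \ C₁).card + Nat.card (H₁ ⊓ H₂ : AddSubgroup G) ∨
      (Nat.card H₂ : ℝ) ≤ (C₁ \ C₂).card + Nat.card (H₁ ⊓ H₂ : AddSubgroup G)) ∨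
      (Nat.card H₂ : ℝ) ≤ (C₂ \ C₁).card := by
  obtain ⟨p, hp⟩ := hne
  rw [Finset.mem_sdiff] at hp
  have hHcard : ∀ H : AddSubgroup G,
      Nat.card H = (Finset.univ.filter fun x => x ∈ H).card := fun H => by
    rw [Nat.card_eq_fintype_card, Fintype.card_subtype]
  have hsplit : ∀ (H : AddSubgroup G) (C : Finset G),
      (Finset.univ.filter fun x => x ∈ H ∧ p + x ∈ C).card
        + (Finset.univ.filter fun x => x ∈ H ∧ p + x ∉ C).card = Nat.card H := fun H C => by
    rw [hHcard, ← Finset.card_filter_add_card_filter_not (s := Finset.univ.filter fun x => x ∈ H)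
      (fun x => p + x ∈ C), Finset.filter_filter, Finset.filter_filter]
  have s1 := hsplit H₁ C₂
  have s2 := hsplit H₂ C₁
  have c1 := card_mul_card_le H₁ H₂ (Finset.univ.filter fun x => x ∈ H₁ ∧ p + x ∈ C₂)
    (Finset.univ.filter fun x => x ∈ H₂ ∧ p + x ∉ C₁) (C₂ \ C₁) p (by simp +contextual)
    (by simp +contextual) (by
      intro x hx y hy
      simp only [Finset.mem_filter, Finset.mem_univ, true_and] at hx hy
      rw [Finset.mem_sdiff, h₂.add_mem_iff hy.1]
      refine ⟨hx.2, ?_⟩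
      rw [add_right_comm, h₁.add_mem_iff hx.1]
      exact hy.2)
  have c2 := card_mul_card_le H₁ H₂ (Finset.univ.filter fun x => x ∈ H₁ ∧ p + x ∉ C₂)
    (Finset.univ.filter fun x => x ∈ H₂ ∧ p + x ∈ C₁) (C₁ \ C₂) p (by simp +contextual)
    (by simp +contextual) (by
      intro x hx y hy
      simp only [Finset.mem_filter, Finset.mem_univ, true_and] at hx hy
      rw [Finset.mem_sdiff, h₂.add_mem_iff hy.1]
      refine ⟨?_, hx.2⟩
      rw [add_right_comm, h₁.add_mem_iff hx.1]
      exact hy.2)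
  have b1 := card_inf_le_of_coset H₁ H₂ (Finset.univ.filter fun x => x ∈ H₁ ∧ p + x ∈ C₂) 0 (by
    intro h hh
    rw [AddSubgroup.mem_inf] at hh
    simp [hh.1, h₂.add_mem_iff hh.2, hp.1])
  have b2 := card_inf_le_of_coset H₁ H₂ (Finset.univ.filter fun x => x ∈ H₂ ∧ p + x ∉ C₁) 0 (by
    intro h hh
    rw [AddSubgroup.mem_inf] at hh
    simp [hh.2, h₁.add_mem_iff hh.1, hp.2])
  have b3 : (Finset.univ.filter fun x => x ∈ H₂ ∧ p + x ∈ C₁).Nonempty →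
      Nat.card (H₁ ⊓ H₂ : AddSubgroup G)
        ≤ (Finset.univ.filter fun x => x ∈ H₂ ∧ p + x ∈ C₁).card := by
    rintro ⟨a, ha⟩
    simp only [Finset.mem_filter, Finset.mem_univ, true_and] at ha
    refine card_inf_le_of_coset H₁ H₂ _ a fun h hh => ?_
    rw [AddSubgroup.mem_inf] at hh
    simp only [Finset.mem_filter, Finset.mem_univ, true_and]
    rw [← add_assoc, h₁.add_mem_iff hh.1]
    exact ⟨H₂.add_mem ha.1 hh.2, ha.2⟩
  have hpos : 0 < Nat.card (H₁ ⊓ H₂ : AddSubgroup G) := Nat.card_pos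
  generalize (Finset.univ.filter fun x => x ∈ H₁ ∧ p + x ∈ C₂).card = x₂ at *
  generalize (Finset.univ.filter fun x => x ∈ H₁ ∧ p + x ∉ C₂).card = v at *
  generalize (Finset.univ.filter fun x => x ∈ H₂ ∧ p + x ∉ C₁).card = u at *
  generalize Nat.card (H₁ ⊓ H₂ : AddSubgroup G) = h at *
  by_cases hne : (Finset.univ.filter fun x => x ∈ H₂ ∧ p + x ∈ C₁).Nonempty
  · left
    have b3 := b3 hne
    generalize (Finset.univ.filter fun x => x ∈ H₂ ∧ p + x ∈ C₁).card = x₁ at *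
    by_contra! hcon
    obtain ⟨k1, k2⟩ := hcon
    have s1' : (x₂ : ℝ) + v = Nat.card H₁ := by exact_mod_cast s1
    have s2' : (x₁ : ℝ) + u = Nat.card H₂ := by exact_mod_cast s2
    have c1' : (x₂ : ℝ) * u ≤ h * (C₂ \ C₁).card := by exact_mod_cast c1
    have c2' : (v : ℝ) * x₁ ≤ h * (C₁ \ C₂).card := by exact_mod_cast c2
    have hpos' : (0 : ℝ) < h := by exact_mod_cast hpos
    have b1' : (h : ℝ) ≤ x₂ := by exact_mod_cast b1
    have b2' : (h : ℝ) ≤ u := by exact_mod_cast b2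
    have b3' : (h : ℝ) ≤ x₁ := by exact_mod_cast b3
    refine union_real_ineq (M₁ := Nat.card H₁) (M₂ := Nat.card H₂) hpos' b2' (by linarith) b1'
      (c1'.trans_lt ?_) ?_
    · exact mul_lt_mul_of_pos_left (by linarith) hpos'
    · rw [← s2', ← s1', add_sub_cancel_right, add_sub_cancel_left, mul_comm, s2']
      refine c2'.trans_lt ?_
      exact mul_lt_mul_of_pos_left (by linarith) hpos'
  · right
    rw [Finset.not_nonempty_iff_eq_empty] at hne
    rw [hne, Finset.card_empty, zero_add] at s2
    subst s2
    have : h * Nat.card H₂ ≤ h * (C₂ \ C₁).card := (Nat.mul_le_mul_right _ b1).trans c1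
    exact_mod_cast Nat.le_of_mul_le_mul_left this hpos

/-- Kneser's lemma on unions of periodic sets. -/
lemma exists_isPer_union {C₁ C₂ : Finset G} {H₁ H₂ : AddSubgroup G} (h₁ : IsPer C₁ H₁)
    (h₂ : IsPer C₂ H₂) {s : ℝ} (s₁ : s ≤ C₁.card + Nat.card H₁) (s₂ : s ≤ C₂.card + Nat.card H₂) :
    ∃ (C : Finset G) (H : AddSubgroup G), (C : Set G) = (C₁ : Set G) ∪ (C₂ : Set G) ∧ IsPer C H ∧
      s ≤ C.card + Nat.card H := by
  suffices ∃ H : AddSubgroup G, IsPer (C₁ ∪ C₂) H ∧ s ≤ (C₁ ∪ C₂).card + Nat.card H by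
    obtain ⟨H, hH, hs⟩ := this
    exact ⟨C₁ ∪ C₂, H, Finset.coe_union _ _, hH, hs⟩
  rcases (C₂ \ C₁).eq_empty_or_nonempty with e | n₂
  · rw [Finset.union_eq_left.2 (Finset.sdiff_eq_empty_iff_subset.1 e)]
    exact ⟨H₁, h₁, s₁⟩
  rcases (C₁ \ C₂).eq_empty_or_nonempty with e | n₁
  · rw [Finset.union_eq_right.2 (Finset.sdiff_eq_empty_iff_subset.1 e)]
    exact ⟨H₂, h₂, s₂⟩
  refine ⟨H₁ ⊓ H₂, ?_, ?_⟩
  · intro x hx h hh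
    rw [AddSubgroup.mem_inf] at hh
    rcases Finset.mem_union.1 hx with hx | hx
    · exact Finset.mem_union_left _ (h₁ x hx h hh.1)
    · exact Finset.mem_union_right _ (h₂ x hx h hh.2)
  · have t₁ := card_sdiff_trichotomy h₁ h₂ n₂
    have t₂ := card_sdiff_trichotomy h₂ h₁ n₁
    rw [inf_comm H₂ H₁] at t₂
    have u₁ : ((C₁ ∪ C₂).card : ℝ) = C₁.card + (C₂ \ C₁).card := by
      rw [add_comm, Finset.union_comm]
      exact_mod_cast (Finset.card_sdiff_add_card C₂ C₁).symm
    have u₂ : ((C₁ ∪ C₂).card : ℝ) = C₂.card + (C₁ \ C₂).card := by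
      rw [add_comm]
      exact_mod_cast (Finset.card_sdiff_add_card C₁ C₂).symm
    have hpos : (0 : ℝ) ≤ Nat.card (H₁ ⊓ H₂ : AddSubgroup G) := by positivity
    rcases t₁ with (t | t) | t₁
    · linarith
    · linarith
    rcases t₂ with (t | t) | t₂
    · linarith
    · linarith
    rcases le_total (Nat.card H₁ : ℝ) (Nat.card H₂) with hle | hle <;> linarith

end Finite

section LocalPeriod

namespace IsInv

variable {m : Set ℤ → ℝ}

/-- The defect of invariance of a set under a translation. -/
def defect (m : Set ℤ → ℝ) (A : Set ℤ) (t : ℤ) : ℝ := m (tr t A \ A)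

lemma defect_neg (h : IsInv m) (A : Set ℤ) (t : ℤ) : defect m A (-t) = defect m A t := by
  have e : tr t (tr (-t) A \ A) = A \ tr t A := by
    ext x; simp
  rw [defect, defect, ← h.shift t, e]
  have h1 := h.inter_diff A (tr t A)
  have h2 := h.inter_diff (tr t A) A
  rw [h.shift, Set.inter_comm] at h2
  linarith

lemma defect_add_le (h : IsInv m) (A : Set ℤ) (s t : ℤ) :
    defect m A (s + t) ≤ defect m A s + defect m A t := by
  rw [defect, defect, defect, ← h.shift t (tr s A \ A)]
  refine (h.mono ?_).trans (h.union_le _ _)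
  intro x
  simp only [Set.mem_sdiff, mem_tr, Set.mem_union, sub_sub, add_comm t s]
  tauto

lemma defect_zero (h : IsInv m) (A : Set ℤ) : defect m A 0 = 0 := by
  simp [defect, h.empty]

/-- A set with small defect along `B` has small defect along the group generated by `B`. -/
lemma defect_closure_le (h : IsInv m) (h1 : m Set.univ = 1) {A B : Set ℤ} {N : ℕ} {η : ℝ}
    (hη : 0 < η) (hN : 1 < N * m B) (hB : ∀ b ∈ B, defect m A b ≤ η) :
    ∀ t ∈ AddSubgroup.closure B, defect m A t ≤ 5 * N * η := by
  by_contra! hcon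
  obtain ⟨t₀, ht₀, hlt⟩ := hcon
  have key : ∀ j : ℕ, j < N → ∃ t, 5 * η * j < defect m A t ∧ defect m A t ≤ 5 * η * j + η := by
    intro j hj
    by_contra! hno
    have hstep : ∀ b ∈ B, ∀ s, (s = b ∨ s = -b) → ∀ y, defect m A y ≤ 5 * η * j →
        defect m A (s + y) ≤ 5 * η * j := by
      intro b hb s hs y hy
      have hsb : defect m A s ≤ η := by
        rcases hs with rfl | rfl
        · exact hB _ hb
        · rw [h.defect_neg]; exact hB _ hb
      have h2 := h.defect_add_le A s y
      by_contra! hgt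
      have := hno _ hgt
      linarith
    have hall : ∀ t ∈ AddSubgroup.closure B, defect m A t ≤ 5 * η * j := by
      intro t ht
      induction ht using AddSubgroup.closure_induction_left with
      | zero => rw [h.defect_zero]; positivity
      | add_left x hx y _ ih => exact hstep x hx x (Or.inl rfl) y ih
      | neg_add_cancel x hx y _ ih => exact hstep x hx (-x) (Or.inr rfl) y ih
    have h2 := hall t₀ ht₀
    have : (j : ℝ) ≤ N := by exact_mod_cast hj.le
    nlinarith
  choose! f hf using key
  refine absurd (h.packing (Finset.range N) f B ?_) (by rw [Finset.card_range, h1]; exact hN.not_ge)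
  have hlt : ∀ i < N, ∀ j < N, i < j → Disjoint (tr (f i) B) (tr (f j) B) := by
    intro i hi j hj hij
    rw [Set.disjoint_left]
    intro x hx hx'
    rw [mem_tr] at hx hx'
    have e1 : f j = f i + (x - f i) + -(x - f j) := by ring
    have e2 := h.defect_add_le A (f i + (x - f i)) (-(x - f j))
    have e3 := h.defect_add_le A (f i) (x - f i)
    have e4 := hB _ hx
    have e5 := hB _ hx'
    rw [← e1, h.defect_neg] at e2
    have e6 := (hf i hi).2
    have e7 := (hf j hj).1
    have e8 : (i : ℝ) + 1 ≤ j := by exact_mod_cast hij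
    nlinarith
  intro i hi j hj hij
  rw [Finset.mem_range] at hi hj
  rcases lt_or_gt_of_ne hij with hij | hij
  · exact hlt i hi j hj hij
  · exact (hlt j hj i hi hij).symm

lemma exists_pos_mem (h : IsInv m) (h1 : m Set.univ = 1) (H : AddSubgroup ℤ) {N : ℕ}
    (hN : 1 < N * m H) : ∃ d : ℕ, 0 < d ∧ d < N ∧ (d : ℤ) ∈ H := by
  by_contra! hcon
  refine absurd (h.packing (Finset.range N) (fun i => (i : ℤ)) H ?_)
    (by rw [Finset.card_range, h1]; exact hN.not_ge)
  have hlt : ∀ i < N, ∀ j < N, i < j → Disjoint (tr (i : ℤ) H) (tr (j : ℤ) H) := by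
    intro i _ j hj hij
    rw [Set.disjoint_left]
    intro x hx hx'
    rw [mem_tr] at hx hx'
    refine hcon (j - i) (by omega) (by omega) ?_
    have := H.sub_mem hx hx'
    rwa [show x - i - (x - j) = ((j - i : ℕ) : ℤ) by push_cast [hij.le]; ring] at this
  intro i hi j hj hij
  rw [Finset.mem_range] at hi hj
  rcases lt_or_gt_of_ne hij with hij | hij
  · exact hlt i hi j hj hij
  · exact (hlt j hj i hi hij).symm

end IsInv

/-- Pairs of sets containing `0` with sumset inside `C` and total mass at least `σ`. -/
structure IsPair (m : Set ℤ → ℝ) (C : Set ℤ) (σ : ℝ) (A B : Set ℤ) : Prop where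
  zero_left : 0 ∈ A
  zero_right : 0 ∈ B
  add_mem : ∀ a ∈ A, ∀ b ∈ B, a + b ∈ C
  mass : σ ≤ m A + m B

variable {m : Set ℤ → ℝ}

lemma IsPair.left_subset {C : Set ℤ} {σ : ℝ} {A B : Set ℤ} (hp : IsPair m C σ A B) : A ⊆ C :=
  fun a ha => by simpa using hp.add_mem a ha 0 hp.zero_right

/-- The Dyson transform of a pair. -/
lemma IsPair.transform (h : IsInv m) {C : Set ℤ} {σ : ℝ} {A B : Set ℤ} (hp : IsPair m C σ A B)
    {e : ℤ} (he : e ∈ A) : IsPair m C σ (A ∪ tr e B) (B ∩ tr (-e) A) := by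
  refine ⟨Or.inl hp.zero_left, ⟨hp.zero_right, by simpa using he⟩, ?_, ?_⟩
  · rintro a (ha | ha) b ⟨hb, hb'⟩
    · exact hp.add_mem a ha b hb
    · rw [mem_tr] at ha hb'
      rw [show a + b = (b - -e) + (a - e) by ring]
      exact hp.add_mem _ hb' _ ha
  · have e1 : m (B ∩ tr (-e) A) = m (A ∩ tr e B) := by
      rw [← h.shift e]
      congr 1
      ext x
      simp [and_comm]
    have e2 := h.union_inter A (tr e B)
    rw [h.shift] at e2
    rw [e1]
    linarith [hp.mass]

/-- Correlations of a pair are bounded below at every element of the difference set. -/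
lemma IsPair.le_correlation (h : IsInv m) {C : Set ℤ} {σ : ℝ} {A B : Set ℤ}
    (hp : IsPair m C σ A B) {e b : ℤ} (hb : b ∈ B) (he : e + b ∈ A) :
    σ - m C ≤ m (A ∩ tr e B) := by
  have e1 : m (A ∪ tr e B) ≤ m C := by
    rw [← h.shift (-b) C]
    refine h.mono ?_
    rintro x (hx | hx)
    · simpa using hp.add_mem x hx b hb
    · rw [mem_tr] at hx ⊢
      rw [show x - -b = (e + b) + (x - e) by ring]
      exact hp.add_mem _ he _ hx
  have e2 := h.union_inter A (tr e B)
  rw [h.shift] at e2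
  linarith [hp.mass]

/-- A pair can be replaced by one for which translates of the right set by elements of the left
set almost stay in the left set. -/
lemma IsPair.exists_minimal (h : IsInv m) {C : Set ℤ} {σ : ℝ} {A₀ B₀ : Set ℤ}
    (hp₀ : IsPair m C σ A₀ B₀) {ε : ℝ} (hε : 0 < ε) :
    ∃ A B, IsPair m C σ A B ∧ ∀ e ∈ A, m B - ε ≤ m (A ∩ tr e B) := by
  set V : Set ℝ := {r | ∃ A B, IsPair m C σ A B ∧ m B = r}
  have hV : V.Nonempty := ⟨_, A₀, B₀, hp₀, rfl⟩
  have hbdd : BddBelow V := ⟨0, by rintro _ ⟨A, B, -, rfl⟩; exact h.nonneg B⟩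
  obtain ⟨_, ⟨A, B, hp, rfl⟩, hlt⟩ := exists_lt_of_csInf_lt hV (lt_add_of_pos_right (sInf V) hε)
  refine ⟨A, B, hp, fun e he => ?_⟩
  have e1 : m (B ∩ tr (-e) A) = m (A ∩ tr e B) := by
    rw [← h.shift e]
    congr 1
    ext x
    simp [and_comm]
  have := csInf_le hbdd ⟨_, _, hp.transform h he, rfl⟩
  linarith

lemma IsErg.le_one (h : IsErg m) (S : Set ℤ) : m S ≤ 1 := h.univ ▸ h.mono (Set.subset_univ S)

/-- For an almost minimal pair the left set is almost invariant under the right set. -/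
lemma IsPair.defect_le (h : IsErg m) {C : Set ℤ} {σ : ℝ} {A B : Set ℤ} (hp : IsPair m C σ A B)
    (hσ : m C < σ) {ε : ℝ} (hε : 0 < ε) (hmin : ∀ e ∈ A, m B - ε ≤ m (A ∩ tr e B)) :
    ∀ b ∈ B, IsInv.defect m A b ≤ ε / (σ - m C) := by
  have hδ : 0 < σ - m C := sub_pos.2 hσ
  set D : Set ℤ := {e | ∃ b ∈ B, e + b ∈ A}
  have key := h.correlation_le A B A (D \ A) (m B - ε) (σ - m C) (fun t => by
    by_cases hA : t ∈ A
    · have : t ∉ D \ A := fun ht => ht.2 hA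
      simpa [hA, this] using hmin t hA
    · by_cases hD : t ∈ D
      · obtain ⟨b, hb, htb⟩ := id hD
        have : t ∈ D \ A := ⟨hD, hA⟩
        simpa [hA, this] using hp.le_correlation h.toIsInv hb htb
      · have : t ∉ D \ A := fun ht => hD ht.1
        simpa [hA, this] using h.nonneg _)
  have hD : m (D \ A) ≤ ε / (σ - m C) := by
    rw [le_div_iff₀ hδ]
    nlinarith [h.le_one A]
  intro b hb
  rw [← h.defect_neg]
  refine (h.mono ?_).trans hD
  rintro x ⟨hx, hx'⟩
  exact ⟨⟨b, hb, by simpa using hx⟩, hx'⟩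

/-- Every element of the sumset lies in a periodic set almost contained in the sumset (here the
element is `0`). -/
lemma IsPair.exists_isPer (h : IsErg m) {C : Set ℤ} {σ : ℝ} {A₀ B₀ : Set ℤ}
    (hp₀ : IsPair m C σ A₀ B₀) (hσ : m C < σ) {N K : ℕ} [NeZero K] (hN : 1 < N * (σ - m C))
    (hK : ∀ d : ℕ, 0 < d → d < N → d ∣ K) {τ : ℝ} (hτ : 0 < τ) :
    ∃ (S : Finset (ZMod K)) (H : AddSubgroup (ZMod K)), IsPer S H ∧ 0 ∈ S ∧
      m (lift (S : Set (ZMod K)) \ C) ≤ τ ∧ σ * K ≤ S.card + Nat.card H := by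
  classical
  set δ := σ - m C with hδdef
  have hδ : 0 < δ := sub_pos.2 hσ
  have hKpos : (0 : ℝ) < K := by exact_mod_cast Nat.pos_of_ne_zero (NeZero.ne K)
  obtain ⟨ε, hε, hετ⟩ : ∃ ε : ℝ, 0 < ε ∧ K * ((ε + 5 * N * (ε / δ)) / δ) = τ := by
    refine ⟨τ * δ / (K * (1 + 5 * N / δ)), by positivity, ?_⟩
    have : 1 + 5 * N / δ ≠ 0 := by positivity
    field_simp
  obtain ⟨A, B, hp, hmin⟩ := hp₀.exists_minimal h.toIsInv hε
  have hmB : δ ≤ m B := by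
    have := h.mono hp.left_subset
    linarith [hp.mass]
  have hNB : 1 < N * m B := hN.trans_le (mul_le_mul_of_nonneg_left hmB (by positivity))
  have hclos := h.defect_closure_le h.univ (div_pos hε hδ) hNB (hp.defect_le h hσ hε hmin)
  set L := AddSubgroup.closure B
  have hBL : B ⊆ L := AddSubgroup.subset_closure
  have hKL : (K : ℤ) ∈ L := by
    obtain ⟨d, hd0, hdN, hdL⟩ := h.exists_pos_mem h.univ L (N := N)
      (hNB.trans_le (mul_le_mul_of_nonneg_left (h.mono hBL) (by positivity)))
    obtain ⟨q, rfl⟩ := hK d hd0 hdN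
    have := L.zsmul_mem hdL q
    rwa [smul_eq_mul, mul_comm, ← Nat.cast_mul] at this
  set H : AddSubgroup (ZMod K) := L.map (Int.castAddHom (ZMod K)) with hH
  set S : Finset (ZMod K) :=
    Finset.univ.filter fun r => ∃ a ∈ A, ∃ l ∈ L, ((a + l : ℤ) : ZMod K) = r with hS
  have hmS : ∀ r, r ∈ S ↔ ∃ a ∈ A, ∃ l ∈ L, ((a + l : ℤ) : ZMod K) = r := by simp [hS]
  refine ⟨S, H, ?_, ?_, ?_, ?_⟩
  · intro x hx y hy
    obtain ⟨a, ha, l, hl, rfl⟩ := (hmS x).1 hx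
    obtain ⟨l', hl', rfl⟩ := AddSubgroup.mem_map.1 hy
    refine (hmS _).2 ⟨a, ha, l + l', L.add_mem hl hl', ?_⟩
    simp [add_assoc]
  · exact (hmS 0).2 ⟨0, hp.zero_left, 0, L.zero_mem, by simp⟩
  · have hr : ∀ r ∈ S, m (lift {r} \ C) ≤ (ε + 5 * N * (ε / δ)) / δ := by
      intro r hr
      obtain ⟨a, ha, l, hl, rfl⟩ := (hmS r).1 hr
      rw [le_div_iff₀ hδ]
      refine (mul_le_mul_of_nonneg_left hmB (h.nonneg _)).trans (h.mul_le _ _ _ fun t => ?_)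
      rcases ((lift {((a + l : ℤ) : ZMod K)} \ C) ∩ tr t B).eq_empty_or_nonempty with he | ⟨x, hx⟩
      · rw [he, h.empty]; positivity
      · have hxr : ((x : ℤ) : ZMod K) = ((a + l : ℤ) : ZMod K) := hx.1.1
        rw [ZMod.intCast_eq_intCast_iff_dvd_sub] at hxr
        obtain ⟨q, hq⟩ := hxr
        have hl' : t - a ∈ L := by
          have h1 := hBL hx.2
          have h2 := L.zsmul_mem hKL q
          rw [smul_eq_mul] at h2
          have h3 := L.sub_mem (L.sub_mem hl h2) h1
          rwa [show l - q * K - (x - t) = t - a by linarith] at h3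
        calc m ((lift {((a + l : ℤ) : ZMod K)} \ C) ∩ tr t B)
            ≤ m (tr (t - a) (tr a B \ A) ∪ (tr (t - a) A \ A)) := by
              refine h.mono ?_
              rintro y ⟨⟨-, hyC⟩, hyB⟩
              have hyA : y ∉ A := fun hy => hyC (hp.left_subset hy)
              simp only [Set.mem_union, Set.mem_sdiff, mem_tr] at hyB ⊢
              rw [show y - (t - a) - a = y - t by ring]
              tauto
          _ ≤ m (tr a B \ A) + m (tr (t - a) A \ A) := by
              rw [← h.shift (t - a) (tr a B \ A)]
              exact h.union_le _ _
          _ ≤ ε + 5 * N * (ε / δ) := by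
              refine add_le_add ?_ (hclos _ hl')
              have h1 := h.inter_diff (tr a B) A
              rw [h.shift, Set.inter_comm] at h1
              linarith [hmin a ha]
    have hsub : lift (S : Set (ZMod K)) \ C ⊆ ⋃ r ∈ S, (lift {r} \ C) := by
      rintro x ⟨hx, hx'⟩
      simp only [Set.mem_iUnion]
      exact ⟨(x : ZMod K), by simpa using hx, by simp, hx'⟩
    calc m (lift (S : Set (ZMod K)) \ C) ≤ m (⋃ r ∈ S, (lift {r} \ C)) := h.mono hsub
      _ ≤ ∑ r ∈ S, m (lift {r} \ C) := h.biUnion_le _ _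
      _ ≤ ∑ r ∈ S, (ε + 5 * N * (ε / δ)) / δ := Finset.sum_le_sum hr
      _ = S.card * ((ε + 5 * N * (ε / δ)) / δ) := by simp
      _ ≤ K * ((ε + 5 * N * (ε / δ)) / δ) := by
        have : S.card ≤ K := by simpa using Finset.card_le_univ S
        have : (S.card : ℝ) ≤ K := by exact_mod_cast this
        gcongr
      _ = τ := hετ
  · have hAS : m A ≤ S.card / K := by
      have h1 := h.lift_eq (S : Set (ZMod K))
      rw [Set.ncard_coe_finset, h.univ, mul_one] at h1
      rw [← h1]
      refine h.mono fun a ha => ?_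
      exact (hmS _).2 ⟨a, ha, 0, L.zero_mem, by simp⟩
    have hBH : m B ≤ Nat.card H / K := by
      have h1 := h.lift_eq (H : Set (ZMod K))
      rw [← Nat.card_coe_set_eq, h.univ, mul_one] at h1
      refine (h.mono fun b hb => ?_).trans_eq h1
      exact AddSubgroup.mem_map.2 ⟨b, hBL hb, rfl⟩
    rw [le_div_iff₀ hKpos] at hAS hBH
    nlinarith [hp.mass]

end LocalPeriod

section Period

variable {m : Set ℤ → ℝ}

lemma IsErg.exists_isPer_of_mem (h : IsErg m) {A B : Set ℤ} (hδ : m (A + B) < m A + m B)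
    {N K : ℕ} [NeZero K] (hN : 1 < N * (m A + m B - m (A + B)))
    (hK : ∀ d : ℕ, 0 < d → d < N → d ∣ K) {τ : ℝ} (hτ : 0 < τ) {c : ℤ} (hc : c ∈ A + B) :
    ∃ (S : Finset (ZMod K)) (H : AddSubgroup (ZMod K)), IsPer S H ∧ (c : ZMod K) ∈ S ∧
      m (lift (S : Set (ZMod K)) \ (A + B)) ≤ τ ∧
      (m A + m B) * K ≤ S.card + Nat.card H := by
  obtain ⟨a, ha, b, hb, rfl⟩ := Set.mem_add.1 hc
  have hp : IsPair m (tr (-(a + b)) (A + B)) (m A + m B) (tr (-a) A) (tr (-b) B) :=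
    { zero_left := by simpa using ha
      zero_right := by simpa using hb
      add_mem := fun x hx y hy => by
        rw [mem_tr] at hx hy ⊢
        exact Set.mem_add.2 ⟨_, hx, _, hy, by ring⟩
      mass := by rw [h.shift, h.shift] }
  obtain ⟨S, H, hS, h0, hm, hc⟩ := hp.exists_isPer h (by rwa [h.shift])
    (by rwa [h.shift]) hK hτ
  refine ⟨S.map (Equiv.addRight ((a + b : ℤ) : ZMod K)).toEmbedding, H, ?_, ?_, ?_, ?_⟩
  · intro x hx y hy
    rw [Finset.mem_map_equiv] at hx ⊢
    convert hS _ hx _ hy using 1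
    simp only [Equiv.addRight_symm, Equiv.coe_addRight]
    ring
  · simpa only [Finset.mem_map_equiv, Equiv.addRight_symm, Equiv.coe_addRight,
      add_neg_cancel] using h0
  · rw [← h.shift (a + b)] at hm
    convert hm using 2
    ext x
    simp [sub_eq_add_neg, -neg_add_rev]
  · rwa [Finset.card_map]

/-- Kneser's theorem for an ergodic invariant mean. -/
lemma IsErg.exists_period (h : IsErg m) {A B : Set ℤ} (hA : A.Nonempty) (hB : B.Nonempty)
    (hδ : m (A + B) < m A + m B) :
    ∃ k : ℕ, 0 < k ∧ m ((A + B + (AddSubgroup.zmultiples (k : ℤ) : Set ℤ)) \ (A + B)) = 0 ∧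
      k * (m A + m B - m (A + B)) ≤ 1 := by
  obtain ⟨N, hN⟩ := exists_nat_gt (1 / (m A + m B - m (A + B)))
  rw [div_lt_iff₀ (by linarith)] at hN
  obtain ⟨K, hKdef⟩ : ∃ K : ℕ, K = N.factorial := ⟨_, rfl⟩
  have hK0 : 0 < K := hKdef ▸ N.factorial_pos
  have : NeZero K := ⟨hK0.ne'⟩
  have hK : ∀ d : ℕ, 0 < d → d < N → d ∣ K := fun d h0 h1 =>
    hKdef ▸ Nat.dvd_factorial h0 h1.le
  have hK0' : (0 : ℝ) < K := by exact_mod_cast hK0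
  obtain ⟨τ, hτ', hτ⟩ : ∃ τ : ℝ, (∀ S : Finset (ZMod K),
      m (lift (S : Set (ZMod K)) \ (A + B)) ≤ τ →
        m (lift (S : Set (ZMod K)) \ (A + B)) = 0) ∧ 0 < τ := by
    refine ((eventually_all.2 fun S => ?_).and self_mem_nhdsWithin).exists
      (f := nhdsWithin 0 (Set.Ioi 0))
    rcases (h.nonneg (lift (S : Set (ZMod K)) \ (A + B))).eq_or_lt with e | l
    · exact Eventually.of_forall fun _ _ => e.symm
    · filter_upwards [nhdsWithin_le_nhds (Iio_mem_nhds l)] with τ hτ hle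
      exact absurd hle (not_le.2 hτ)
  have hloc : ∀ c ∈ A + B, ∃ S : Finset (ZMod K), (c : ZMod K) ∈ S ∧ (∃ H, IsPer S H ∧
      (m A + m B) * K ≤ S.card + Nat.card H) ∧ m (lift (S : Set (ZMod K)) \ (A + B)) = 0 := by
    intro c hc
    obtain ⟨S, H, h1, h2, h3, h4⟩ := h.exists_isPer_of_mem hδ hN hK hτ hc
    exact ⟨S, h2, ⟨H, h1, h4⟩, hτ' S h3⟩
  obtain ⟨S, hS⟩ := Set.Finite.exists_maximal (s := {S : Finset (ZMod K) | (∃ H, IsPer S H ∧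
      (m A + m B) * K ≤ S.card + Nat.card H) ∧ m (lift (S : Set (ZMod K)) \ (A + B)) = 0})
    (Set.toFinite _) (by
      obtain ⟨c, hc⟩ := hA.add hB
      obtain ⟨S, -, hS⟩ := hloc c hc
      exact ⟨S, hS⟩)
  obtain ⟨⟨H, hper, hcard⟩, hnull⟩ := hS.prop
  have hCS : A + B ⊆ lift (S : Set (ZMod K)) := by
    intro c hc
    obtain ⟨T, hcT, ⟨H', hper', hcard'⟩, hnull'⟩ := hloc c hc
    obtain ⟨U, J, hU, hUJ, hUc⟩ := exists_isPer_union hper hper' hcard hcard'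
    have hUmem : ∀ x, x ∈ U ↔ x ∈ S ∨ x ∈ T := fun x => by
      rw [← Finset.mem_coe, hU]; simp
    have hUS : U ⊆ S := hS.le_of_ge ⟨⟨J, hUJ, hUc⟩, by
      refine le_antisymm ?_ (h.nonneg _)
      refine (h.mono (T := (lift (S : Set (ZMod K)) \ (A + B)) ∪
        (lift (T : Set (ZMod K)) \ (A + B))) ?_).trans ((h.union_le _ _).trans (by linarith))
      rintro x ⟨hx, hx'⟩
      rcases (hUmem _).1 hx with hx | hx
      · exact Or.inl ⟨hx, hx'⟩
      · exact Or.inr ⟨hx, hx'⟩⟩ fun x hx => (hUmem x).2 (Or.inl hx)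
    exact hUS ((hUmem _).2 (Or.inr hcT))
  obtain ⟨k₀, hk₀⟩ := Int.subgroup_cyclic (H.comap (Int.castAddHom (ZMod K)))
  have hkz : AddSubgroup.zmultiples (k₀.natAbs : ℤ) = H.comap (Int.castAddHom (ZMod K)) := by
    rw [hk₀, ← AddSubgroup.zmultiples_eq_closure]
    simp
  have hKH : (K : ℤ) ∈ H.comap (Int.castAddHom (ZMod K)) := by simp [AddSubgroup.mem_comap]
  generalize k₀.natAbs = k at hkz
  have hk : 0 < k := by
    rcases k.eq_zero_or_pos with rfl | hk
    · rw [← hkz] at hKH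
      simp at hKH
      omega
    · exact hk
  have hmH : m (lift (H : Set (ZMod K))) = Nat.card H / K := by
    rw [h.lift_eq, h.univ, mul_one]; rfl
  have : NeZero k := ⟨hk.ne'⟩
  have hmk : m (lift (H : Set (ZMod K))) = 1 / k := by
    rw [show lift (H : Set (ZMod K)) = lift ({0} : Set (ZMod k)) by
      ext x
      have : x ∈ AddSubgroup.zmultiples (k : ℤ) ↔ (x : ZMod K) ∈ H := by rw [hkz]; simp
      rw [mem_lift, mem_lift, SetLike.mem_coe, ← this, Int.mem_zmultiples_iff,
        Set.mem_singleton_iff, ZMod.intCast_zmod_eq_zero_iff_dvd], h.lift_eq, h.univ]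
    simp
  have hk' : (0 : ℝ) < k := by exact_mod_cast hk
  have hper' : A + B + (AddSubgroup.zmultiples (k : ℤ) : Set ℤ) ⊆ lift (S : Set (ZMod K)) := by
    rintro _ ⟨c, hc, t, ht, rfl⟩
    rw [hkz] at ht
    have := hper _ (hCS hc) _ ht
    simpa using this
  refine ⟨k, hk, le_antisymm ?_ (h.nonneg _), ?_⟩
  · rw [← hnull]
    exact h.mono (Set.sdiff_subset_sdiff_left hper')
  · have h1 := h.lift_eq (S : Set (ZMod K))
    rw [Set.ncard_coe_finset, h.univ, mul_one] at h1
    have h2 := h.diff_of_subset hCS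
    rw [hnull] at h2
    rw [eq_div_iff hK0'.ne'] at h1 hmH
    have h3 : (m A + m B - m (A + B)) * K ≤ 1 / k * K := by
      rw [← hmk]; nlinarith
    have h4 := le_of_mul_le_mul_right h3 hK0'
    rw [le_div_iff₀ hk'] at h4
    linarith

end Period

lemma IsInv.eq_empty_of_periodic {m : Set ℤ → ℝ} (h : IsInv m) (h1 : m Set.univ = 1) {S : Set ℤ}
    (hS : m S = 0) {q : ℕ} (hq : 0 < q) (hper : ∀ x ∈ S, ∀ j : ℤ, x + j * q ∈ S) : S = ∅ := by
  by_contra hne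
  obtain ⟨x, hx⟩ := Set.nonempty_iff_ne_empty.2 hne
  have : NeZero q := ⟨hq.ne'⟩
  have hle : m (lift ({(x : ZMod q)} : Set (ZMod q))) ≤ m S := h.mono fun y hy => by
    obtain ⟨j, hj⟩ := (ZMod.intCast_eq_intCast_iff_dvd_sub x y q).1 (Eq.symm hy)
    have := hper x hx j
    rwa [show x + j * q = y by linarith] at this
  rw [h.lift_singleton, h1, hS] at hle
  have : (0 : ℝ) < 1 / q := by positivity
  linarith

/-- A single period works for all ergodic invariant means. -/
lemma exists_uniform_period {A B : Set ℤ} (hA : A.Nonempty) (hB : B.Nonempty) :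
    ∃ k : ℕ, 0 < k ∧ ∀ m, IsErg m → m (A + B) < m A + m B →
      m ((A + B + (AddSubgroup.zmultiples (k : ℤ) : Set ℤ)) \ (A + B)) = 0 ∧
      k * (m A + m B - m (A + B)) ≤ 1 := by
  classical
  by_cases hex : ∃ k : ℕ, 0 < k ∧ ∃ m, IsErg m ∧ m (A + B) < m A + m B ∧
      m ((A + B + (AddSubgroup.zmultiples (k : ℤ) : Set ℤ)) \ (A + B)) = 0 ∧
      k * (m A + m B - m (A + B)) ≤ 1
  · obtain ⟨hk, m₀, h₀, -, hn₀, -⟩ := Nat.find_spec hex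
    have hmin := fun q => Nat.find_min' hex (m := q)
    generalize Nat.find hex = k at hk hn₀ hmin
    refine ⟨k, hk, fun m h hδ => ?_⟩
    obtain ⟨l, hl, hnl, hlδ⟩ := h.exists_period hA hB hδ
    have hsub : A + B + (AddSubgroup.zmultiples (k : ℤ) : Set ℤ) ⊆
        A + B + (AddSubgroup.zmultiples (l : ℤ) : Set ℤ) := by
      rw [← Set.sdiff_eq_empty]
      refine h₀.eq_empty_of_periodic h₀.univ (le_antisymm ?_ (h₀.nonneg _)) (mul_pos hk hl) ?_
      · rw [← hn₀]
        refine h₀.mono (Set.sdiff_subset_sdiff_right fun c hc => ?_)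
        exact Set.mem_add.2 ⟨c, hc, 0, AddSubgroup.zero_mem _, add_zero c⟩
      · have hper : ∀ q : ℕ, ∀ x ∈ A + B + (AddSubgroup.zmultiples (q : ℤ) : Set ℤ), ∀ j : ℤ,
            x + j * q ∈ A + B + (AddSubgroup.zmultiples (q : ℤ) : Set ℤ) := by
          rintro q _ ⟨c, hc, t, ht, rfl⟩ j
          refine ⟨c, hc, t + j * q, AddSubgroup.add_mem _ ht ?_, by simp only; ring⟩
          exact Int.mem_zmultiples_iff.2 (dvd_mul_left _ _)
        rintro x ⟨hx, hx'⟩ j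
        refine ⟨?_, fun hcon => hx' ?_⟩
        · convert hper k x hx (j * l) using 1
          push_cast; ring
        · convert hper l _ hcon (-(j * k)) using 1
          push_cast; ring
    refine ⟨le_antisymm ?_ (h.nonneg _), ?_⟩
    · rw [← hnl]
      exact h.mono (Set.sdiff_subset_sdiff_left hsub)
    · have hkl : (k : ℝ) ≤ l := by exact_mod_cast hmin l ⟨hl, m, h, hδ, hnl, hlδ⟩
      nlinarith
  · refine ⟨1, one_pos, fun m h hδ => ?_⟩
    obtain ⟨k, hk, hkm⟩ := h.exists_period hA hB hδ
    exact absurd ⟨k, hk, m, h, hδ, hkm⟩ hex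

/-- The invariant means on `ℤ`. -/
def invMeans : Set (Set ℤ → ℝ) := {m | IsInv m ∧ m Set.univ = 1}

lemma isCompact_invMeans : IsCompact invMeans := by
  have hsub : invMeans ⊆ Set.pi Set.univ fun _ => Set.Icc (0 : ℝ) 1 := fun m hm S _ =>
    ⟨hm.1.nonneg S, hm.2 ▸ hm.1.mono (Set.subset_univ S)⟩
  refine (isCompact_univ_pi fun _ => isCompact_Icc).of_isClosed_subset ?_ hsub
  have e : invMeans = {m | ∀ S, 0 ≤ m S} ∩ {m | ∀ S T, Disjoint S T → m (S ∪ T) = m S + m T} ∩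
      {m | ∀ t S, m (tr t S) = m S} ∩ {m | m Set.univ = 1} := by
    ext m
    exact ⟨fun ⟨⟨h1, h2, h3⟩, h4⟩ => ⟨⟨⟨h1, h2⟩, h3⟩, h4⟩,
      fun ⟨⟨⟨h1, h2⟩, h3⟩, h4⟩ => ⟨⟨h1, h2, h3⟩, h4⟩⟩
  rw [e]
  simp only [Set.ofPred_forall]
  refine ((IsClosed.inter ?_ ?_).inter ?_).inter ?_
  · exact isClosed_iInter fun S => isClosed_le continuous_const (continuous_apply S)
  · exact isClosed_iInter fun S => isClosed_iInter fun T => isClosed_iInter fun _ =>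
      isClosed_eq (continuous_apply _) ((continuous_apply S).add (continuous_apply T))
  · exact isClosed_iInter fun t => isClosed_iInter fun S =>
      isClosed_eq (continuous_apply _) (continuous_apply S)
  · exact isClosed_eq (continuous_apply _) continuous_const

lemma IsInv.const_mul {m : Set ℤ → ℝ} (h : IsInv m) {c : ℝ} (hc : 0 ≤ c) :
    IsInv fun S => c * m S where
  nonneg S := mul_nonneg hc (h.nonneg S)
  union S T hST := by rw [h.union S T hST, mul_add]
  shift t S := by rw [h.shift]

lemma IsInv.sub {m ν : Set ℤ → ℝ} (h : IsInv m) (hν : IsInv ν) (hle : ∀ S, ν S ≤ m S) :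
    IsInv fun S => m S - ν S where
  nonneg S := sub_nonneg.2 (hle S)
  union S T hST := by rw [h.union S T hST, hν.union S T hST]; ring
  shift t S := by rw [h.shift, hν.shift]

lemma IsInv.eq_zero {m : Set ℤ → ℝ} (h : IsInv m) (h0 : m Set.univ = 0) (S : Set ℤ) : m S = 0 :=
  le_antisymm (h0 ▸ h.mono (Set.subset_univ S)) (h.nonneg S)

lemma IsInv.inv_mul_mem {m : Set ℤ → ℝ} (h : IsInv m) (h0 : 0 < m Set.univ) :
    (fun S => (m Set.univ)⁻¹ * m S) ∈ invMeans :=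
  ⟨h.const_mul (inv_nonneg.2 h0.le), inv_mul_cancel₀ h0.ne'⟩

lemma isErg_of_mem_extremePoints {m : Set ℤ → ℝ} (hm : m ∈ invMeans.extremePoints ℝ) :
    IsErg m := by
  rw [mem_extremePoints_iff_left] at hm
  obtain ⟨⟨h, h1⟩, hext⟩ := hm
  refine ⟨h, h1, fun ν hν hle S => ?_⟩
  have hd := h.sub hν hle
  rcases (hν.nonneg Set.univ).eq_or_lt with e | hpos
  · rw [hν.eq_zero e.symm S, ← e, zero_mul]
  rcases (hle Set.univ).eq_or_lt with e | hlt
  · have := hd.eq_zero (by rw [e, sub_self]) S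
    rw [e, h1]
    linarith
  have hpos' : 0 < m Set.univ - ν Set.univ := sub_pos.2 hlt
  have key := hext _ (hν.inv_mul_mem hpos) _ (hd.inv_mul_mem hpos')
    ⟨ν Set.univ, m Set.univ - ν Set.univ, hpos, hpos', by rw [h1]; ring, by
      ext T
      simp only [Pi.add_apply, Pi.smul_apply, smul_eq_mul]
      field_simp
      ring⟩
  rw [← key]
  field_simp

/-- A linear inequality valid for all ergodic invariant means is valid for all invariant
finitely additive measures. -/
lemma IsInv.apply_nonpos {m : Set ℤ → ℝ} (h : IsInv m) (L : StrongDual ℝ (Set ℤ → ℝ))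
    (hL : ∀ ν, IsErg ν → L ν ≤ 0) : L m ≤ 0 := by
  rcases (h.nonneg Set.univ).eq_or_lt with e | hpos
  · rw [show m = 0 from funext (h.eq_zero e.symm), map_zero]
  have hmem := h.inv_mul_mem hpos
  obtain ⟨x, hx, hmax⟩ := isCompact_invMeans.exists_isMaxOn ⟨_, hmem⟩ L.continuous.continuousOn
  have hexp : IsExposed ℝ invMeans (L.toExposed invMeans) :=
    ContinuousLinearMap.toExposed.isExposed
  obtain ⟨y, hy⟩ := (hexp.isCompact isCompact_invMeans).extremePoints_nonempty
    ⟨x, hx, fun z hz => hmax hz⟩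
  have hLy := hL y
    (isErg_of_mem_extremePoints (hexp.isExtreme.extremePoints_subset_extremePoints hy))
  have hle := (hy.1.2 _ hmem).trans hLy
  rw [show (fun S => (m Set.univ)⁻¹ * m S) = (m Set.univ)⁻¹ • m from rfl, map_smul,
    smul_eq_mul] at hle
  by_contra! hcon
  have := mul_pos (inv_pos.2 hpos) hcon
  linarith

/-- The left endpoints of the windows of length `M` in which `P` does not exceed `C`. -/
def core (C P : Set ℤ) (M : ℕ) : Set ℤ := {x | ∀ i < M, x + (i : ℤ) ∈ P → x + (i : ℤ) ∈ C}

lemma IsErg.core_eq_one {m : Set ℤ → ℝ} (h : IsErg m) {C P : Set ℤ} (hP : m (P \ C) = 0)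
    (M : ℕ) : m (core C P M) = 1 := by
  have hsub : Set.univ \ core C P M ⊆ ⋃ i ∈ Finset.range M, tr (-(i : ℤ)) (P \ C) := by
    rintro x ⟨-, hx⟩
    simp only [core, Set.mem_ofPred_eq, not_forall] at hx
    obtain ⟨i, hi, hiP, hiC⟩ := hx
    simp only [Set.mem_iUnion, Finset.mem_range]
    exact ⟨i, hi, by simpa using ⟨hiP, hiC⟩⟩
  have h1 := (h.mono hsub).trans (h.biUnion_le _ _)
  simp only [h.shift, hP, Finset.sum_const_zero] at h1
  rw [h.diff_of_subset (Set.subset_univ _), h.univ] at h1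
  exact le_antisymm (h.le_one _) (by linarith)

/-- The period `k` controls the mass of the core with respect to every invariant measure. -/
lemma exists_le_core {A B : Set ℤ} (hA : A.Nonempty) (hB : B.Nonempty) :
    ∃ k : ℕ, 0 < k ∧ ∀ m, IsInv m → ∀ M, k * (m A + m B - m (A + B)) ≤
      m (core (A + B) (A + B + (AddSubgroup.zmultiples (k : ℤ) : Set ℤ)) M) := by
  obtain ⟨k, hk, hkm⟩ := exists_uniform_period hA hB
  refine ⟨k, hk, fun m h M => ?_⟩
  let π : Set ℤ → StrongDual ℝ (Set ℤ → ℝ) := fun S => ContinuousLinearMap.proj S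
  have := h.apply_nonpos ((k : ℝ) • (π A + π B - π (A + B)) -
    π (core (A + B) (A + B + (AddSubgroup.zmultiples (k : ℤ) : Set ℤ)) M)) fun ν hν => by
      simp only [π, sub_apply, smul_apply,
        add_apply, ContinuousLinearMap.proj_apply, smul_eq_mul]
      rcases lt_or_ge (ν (A + B)) (ν A + ν B) with hδ | hδ
      · obtain ⟨h1, h2⟩ := hkm ν hν hδ
        rw [hν.core_eq_one h1]
        linarith
      · have h1 := hν.nonneg
          (core (A + B) (A + B + (AddSubgroup.zmultiples (k : ℤ) : Set ℤ)) M)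
        have h2 : (k : ℝ) * (ν A + ν B - ν (A + B)) ≤ 0 :=
          mul_nonpos_of_nonneg_of_nonpos (by positivity) (by linarith)
        linarith
  simp only [π, sub_apply, smul_apply,
    add_apply, ContinuousLinearMap.proj_apply, smul_eq_mul] at this
  linarith

section Density

variable {F : ℕ → Finset ℤ}

lemma add_singleton_eq_tr (S : Set ℤ) (t : ℤ) : S + {t} = tr t S := by
  ext x
  simp [sub_eq_add_neg]

lemma ncard_tr (t : ℤ) (S : Set ℤ) : (tr t S).ncard = S.ncard := by
  rw [← add_singleton_eq_tr, Set.add_singleton]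
  exact Set.ncard_image_of_injective _ (add_left_injective t)

lemma finite_tr {S : Set ℤ} (hS : S.Finite) (t : ℤ) : (tr t S).Finite := by
  rw [← add_singleton_eq_tr]
  exact hS.add (Set.finite_singleton t)

lemma dens_mem_Icc (S : Set ℤ) (n : ℕ) : dens F S n ∈ Set.Icc (0 : ℝ) 1 := by
  refine ⟨by unfold dens; positivity, div_le_one_of_le₀ ?_ (by positivity)⟩
  have := Set.ncard_le_ncard (s := S ∩ F n) Set.inter_subset_right (F n).finite_toSet
  rw [Set.ncard_coe_finset] at this
  exact_mod_cast this

lemma dens_univ (hF : IsFolnerSeq F) (n : ℕ) : dens F Set.univ n = 1 := by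
  rw [dens, Set.univ_inter, Set.ncard_coe_finset]
  exact div_self (by exact_mod_cast (hF.1 n).card_pos.ne')

lemma dens_union {S T : Set ℤ} (hST : Disjoint S T) (n : ℕ) :
    dens F (S ∪ T) n = dens F S n + dens F T n := by
  rw [dens, dens, dens, Set.union_inter_distrib_right, Set.ncard_union_eq
    (hST.mono Set.inter_subset_left Set.inter_subset_left) ((F n).finite_toSet.inter_of_right _)
    ((F n).finite_toSet.inter_of_right _), Nat.cast_add, add_div]

lemma ncard_inter_le {G H : Set ℤ} (hG : G.Finite) (hH : H.Finite) (E : Set ℤ) :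
    (E ∩ G).ncard ≤ (E ∩ H).ncard + (symmDiff G H).ncard := by
  refine (Set.ncard_le_ncard ?_ ((hH.inter_of_right _).union (hG.symmDiff hH))).trans
    (Set.ncard_union_le _ _)
  rintro x ⟨hE, hx⟩
  by_cases hx' : x ∈ H
  · exact Or.inl ⟨hE, hx'⟩
  · exact Or.inr (Or.inl ⟨hx, hx'⟩)

lemma abs_dens_tr_sub_le (t : ℤ) (S : Set ℤ) (n : ℕ) : |dens F (tr t S) n - dens F S n| ≤
    ((symmDiff (F n : Set ℤ) ((F n : Set ℤ) + {t})).ncard : ℝ) / (F n).card := by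
  have hfin := (F n).finite_toSet
  rw [add_singleton_eq_tr, dens, dens, ← sub_div, abs_div, Nat.abs_cast]
  refine div_le_div_of_nonneg_right ?_ (by positivity)
  rw [← ncard_tr t (S ∩ F n), show tr t (S ∩ F n) = tr t S ∩ tr t (F n) from rfl, abs_le']
  have h1 := ncard_inter_le hfin (finite_tr hfin t) (tr t S)
  have h2 := ncard_inter_le (finite_tr hfin t) hfin (tr t S)
  rw [symmDiff_comm] at h2
  rify at h1 h2
  constructor <;> linarith

lemma exists_mean (hF : IsFolnerSeq F) (C : Set ℤ) : ∃ (U : Ultrafilter ℕ) (m : Set ℤ → ℝ),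
    (U : Filter ℕ) ≤ atTop ∧ IsInv m ∧ m Set.univ = 1 ∧
      (∀ S, Tendsto (dens F S) U (nhds (m S))) ∧ m C ≤ liminf (dens F C) atTop := by
  have hbdd : IsBoundedUnder (· ≥ ·) atTop (dens F C) :=
    isBoundedUnder_of ⟨0, fun n => (dens_mem_Icc C n).1⟩
  have hcob : IsCoboundedUnder (· ≥ ·) atTop (dens F C) :=
    (isBoundedUnder_of ⟨1, fun n => (dens_mem_Icc C n).2⟩ :
      IsBoundedUnder (· ≤ ·) atTop (dens F C)).isCoboundedUnder_ge
  obtain ⟨φ, hφ, hφC⟩ := extraction_forall_of_frequently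
    (P := fun j n => dens F C n < liminf (dens F C) atTop + 1 / ((j : ℝ) + 1)) fun j =>
      frequently_lt_of_liminf_lt hcob (lt_add_of_pos_right _ (by positivity))
  have hUtop : ((hyperfilter ℕ).map φ : Filter ℕ) ≤ atTop :=
    (hφ.tendsto_atTop.mono_left (Nat.hyperfilter_le_atTop))
  obtain ⟨m, hm⟩ := exists_ultrafilter_limit ((hyperfilter ℕ).map φ) (fun n S => dens F S n)
    fun n S => dens_mem_Icc S n
  refine ⟨_, m, hUtop, ⟨fun S => ?_, fun S T hST => ?_, fun t S => ?_⟩, ?_, hm, ?_⟩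
  · exact ge_of_tendsto' (hm S) fun n => (dens_mem_Icc S n).1
  · refine tendsto_nhds_unique (hm _) (((hm S).add (hm T)).congr fun n => ?_)
    rw [dens_union hST]
  · have h1 := (hm (tr t S)).sub (hm S)
    have h2 := squeeze_zero_norm (f := fun n => dens F (tr t S) n - dens F S n)
      (fun n => abs_dens_tr_sub_le t S n)
      ((hF.2 t).mono_left hUtop)
    exact sub_eq_zero.1 (tendsto_nhds_unique h1 h2)
  · refine tendsto_nhds_unique (hm _) (tendsto_const_nhds.congr fun n => ?_)
    rw [dens_univ hF]
  · have h1 := (tendsto_inv_hyperfilter 1).const_add (liminf (dens F C) atTop)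
    rw [add_zero] at h1
    have h2 : Tendsto (dens F C ∘ φ) (hyperfilter ℕ) (nhds (m C)) :=
      (hm C).comp (tendsto_map (f := φ) (x := (hyperfilter ℕ : Filter ℕ)))
    exact le_of_tendsto_of_tendsto' h2 h1 fun j => (hφC j).le

lemma liminf_dens_le {U : Ultrafilter ℕ} (hU : (U : Filter ℕ) ≤ atTop) {S : Set ℤ} {y : ℝ}
    (hy : Tendsto (dens F S) U (nhds y)) : liminf (dens F S) atTop ≤ y := by
  rw [← hy.liminf_eq]
  exact liminf_le_liminf_of_le hU (isBoundedUnder_of ⟨0, fun n => (dens_mem_Icc S n).1⟩)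
    hy.isBoundedUnder_le.isCoboundedUnder_ge

end Density

section Limit

variable {m : Set ℤ → ℝ} {Z : ℕ → Set ℤ}

/-- The part of an invariant measure escaping along a decreasing, asymptotically invariant
sequence of sets is invariant. -/
lemma IsInv.exists_limit (h : IsInv m) (hZ : Antitone Z) (hZ' : ∀ M, Z (M + 1) ⊆ tr (-1) (Z M)) :
    ∃ μ : Set ℤ → ℝ, (∀ S, Tendsto (fun M => m (S ∩ Z M)) atTop (nhds (μ S))) ∧
      IsInv fun S => m S - μ S := by
  have hlim : ∀ S, ∃ y, Tendsto (fun M => m (S ∩ Z M)) atTop (nhds y) := fun S =>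
    ⟨_, tendsto_atTop_ciInf (fun M N hMN => h.mono (Set.inter_subset_inter_right S (hZ hMN)))
      ⟨0, Set.forall_mem_range.2 fun M => h.nonneg _⟩⟩
  choose μ hμ using hlim
  refine ⟨μ, hμ, IsInv.of_shift_one (fun S => ?_) (fun S T hST => ?_) fun S => ?_⟩
  · exact sub_nonneg.2 (le_of_tendsto' (hμ S) fun M => h.mono Set.inter_subset_left)
  · have : μ (S ∪ T) = μ S + μ T :=
      tendsto_nhds_unique (hμ _) (((hμ S).add (hμ T)).congr fun M => by
        rw [Set.union_inter_distrib_right, h.union _ _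
          (hST.mono Set.inter_subset_left Set.inter_subset_left)])
    rw [this, h.union S T hST]
    ring
  · rw [h.shift]
    congr 1
    have h1 := (hμ S).comp (tendsto_add_atTop_nat 1)
    have h2 := (hμ Set.univ).sub ((hμ Set.univ).comp (tendsto_add_atTop_nat 1))
    have h3 := h1.add h2
    rw [sub_self, add_zero] at h3
    refine tendsto_nhds_unique (hμ (tr 1 S)) (tendsto_of_tendsto_of_tendsto_of_le_of_le h1 h3 ?_ ?_)
    all_goals
      intro M
      have e : m (tr 1 S ∩ Z M) = m (S ∩ tr (-1) (Z M)) := by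
        rw [← h.shift 1 (S ∩ tr (-1) (Z M))]
        congr 1
        ext x
        simp
      simp only [e, Function.comp_apply, Set.univ_inter]
    · exact h.mono (Set.inter_subset_inter_right S (hZ' M))
    · have h4 := h.diff_of_subset (hZ' M)
      rw [h.shift] at h4
      rw [← h4]
      refine (h.mono fun x hx => ?_).trans (h.union_le _ _)
      by_cases hx' : x ∈ Z (M + 1)
      · exact Or.inl ⟨hx.1, hx'⟩
      · exact Or.inr ⟨hx.2, hx'⟩

lemma IsInv.exists_limit_le (h : IsInv m) (hZ : Antitone Z)
    (hZ' : ∀ M, Z (M + 1) ⊆ tr (-1) (Z M)) {A B C : Set ℤ} {k : ℕ} (hk : 0 < k)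
    (hkZ : ∀ ν, IsInv ν → ∀ M, k * (ν A + ν B - ν C) ≤ ν (Z M)) :
    ∃ μ : Set ℤ → ℝ, (∀ S, Tendsto (fun M => m (S ∩ Z M)) atTop (nhds (μ S))) ∧
      m A + m B - m C ≤ μ A + μ B - μ C ∧ k * (m A + m B - m C) ≤ μ Set.univ := by
  obtain ⟨μ, hμ, hν⟩ := h.exists_limit hZ hZ'
  have hμu : Tendsto (fun M => m (Z M)) atTop (nhds (μ Set.univ)) := by
    simpa only [Set.univ_inter] using hμ Set.univ
  refine ⟨μ, hμ, ?_, ge_of_tendsto' hμu (hkZ m h)⟩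
  have hμZ : ∀ M, μ (Z M) = μ Set.univ := fun M => by
    refine tendsto_nhds_unique (hμ (Z M)) (hμu.congr' ?_)
    filter_upwards [eventually_ge_atTop M] with N hN
    rw [Set.inter_eq_self_of_subset_right (hZ hN)]
  have h1 := hμu.sub_const (μ Set.univ)
  rw [sub_self] at h1
  have h2 := ge_of_tendsto' h1 fun M => (hkZ _ hν M).trans_eq (by rw [hμZ])
  have h3 := nonpos_of_mul_nonpos_right h2 (show (0 : ℝ) < k by exact_mod_cast hk)
  linarith

end Limit

section Trace

variable {F : ℕ → Finset ℤ} {m : Set ℤ → ℝ} {Z : ℕ → Set ℤ}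

lemma ncard_symmDiff_tr_add_le {G : Set ℤ} (hG : G.Finite) (s t : ℤ) :
    (symmDiff G (tr (s + t) G)).ncard ≤
      (symmDiff G (tr s G)).ncard + (symmDiff G (tr t G)).ncard := by
  have hs := hG.symmDiff (finite_tr hG s)
  have ht := hG.symmDiff (finite_tr hG t)
  rw [← ncard_tr t (symmDiff G (tr s G))]
  refine (Set.ncard_le_ncard ?_ ((finite_tr hs t).union ht)).trans (Set.ncard_union_le _ _)
  intro x
  simp only [Set.mem_symmDiff, mem_tr, Set.mem_union, sub_sub, add_comm t s]
  tauto

lemma ncard_symmDiff_tr_neg (G : Set ℤ) (t : ℤ) :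
    (symmDiff G (tr (-t) G)).ncard = (symmDiff G (tr t G)).ncard := by
  rw [← ncard_tr t (symmDiff G (tr (-t) G))]
  congr 1
  ext x
  simp only [Set.mem_symmDiff, mem_tr, sub_neg_eq_add, sub_add_cancel]
  tauto

lemma isFolnerSeq_of_one (hne : ∀ n, (F n).Nonempty)
    (h1 : Tendsto (fun n => ((symmDiff (F n : Set ℤ) (tr 1 (F n))).ncard : ℝ) / (F n).card)
      atTop (nhds 0)) : IsFolnerSeq F := by
  refine ⟨hne, fun t => ?_⟩
  simp only [add_singleton_eq_tr]
  have hstep : ∀ s t : ℤ,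
      Tendsto (fun n => ((symmDiff (F n : Set ℤ) (tr s (F n))).ncard : ℝ) / (F n).card)
        atTop (nhds 0) →
      Tendsto (fun n => ((symmDiff (F n : Set ℤ) (tr t (F n))).ncard : ℝ) / (F n).card)
        atTop (nhds 0) →
      Tendsto (fun n => ((symmDiff (F n : Set ℤ) (tr (s + t) (F n))).ncard : ℝ) / (F n).card)
        atTop (nhds 0) := fun s t hs ht => by
    have hst := hs.add ht
    rw [add_zero] at hst
    refine squeeze_zero (fun n => by positivity) (fun n => ?_) hst
    rw [← add_div]
    refine div_le_div_of_nonneg_right ?_ (by positivity)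
    exact_mod_cast ncard_symmDiff_tr_add_le (F n).finite_toSet s t
  induction t using Int.induction_on with
  | zero => simp
  | succ t ih => exact hstep _ _ ih h1
  | pred t ih => exact hstep _ _ ih (by simpa only [ncard_symmDiff_tr_neg] using h1)

lemma exists_diagonal {U : Ultrafilter ℕ} (hU : (U : Filter ℕ) ≤ atTop)
    (hm : ∀ S, Tendsto (dens F S) U (nhds (m S))) (hZ : ∀ j, 0 < m (Z j))
    {s : Set ((ℕ → Set ℤ) × ℝ)} (hs : s.Finite)
    (hlim : ∀ p ∈ s, Tendsto (fun j => m (p.1 j)) atTop (nhds p.2)) :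
    ∃ n : ℕ → ℕ, StrictMono n ∧ (∀ j, 0 < dens F (Z j) (n j)) ∧
      ∀ p ∈ s, Tendsto (fun j => dens F (p.1 j) (n j)) atTop (nhds p.2) := by
  obtain ⟨n, hn, hP⟩ := extraction_forall_of_frequently
    (P := fun j i => 0 < dens F (Z j) i ∧
      ∀ p ∈ s, |dens F (p.1 j) i - m (p.1 j)| < 1 / ((j : ℝ) + 1)) fun j => by
    refine Frequently.filter_mono (Eventually.frequently (f := (U : Filter ℕ)) ?_) hU
    refine ((hm (Z j)).eventually (lt_mem_nhds (hZ j))).and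
      ((eventually_all_finite hs).2 fun p _ => ?_)
    have h1 := ((hm (p.1 j)).sub_const (m (p.1 j))).abs
    rw [sub_self, abs_zero] at h1
    exact h1.eventually (gt_mem_nhds (by positivity))
  refine ⟨n, hn, fun j => (hP j).1, fun p hp => ?_⟩
  have h1 := squeeze_zero_norm (f := fun j => dens F (p.1 j) (n j) - m (p.1 j))
    (fun j => ((hP j).2 p hp).le) tendsto_one_div_add_atTop_nhds_zero_nat
  simpa using h1.add (hlim p hp)

open Classical in
/-- The trace of the sets `Z j` on a subsequence of `F`. -/
noncomputable def trace (F : ℕ → Finset ℤ) (Z : ℕ → Set ℤ) (n : ℕ → ℕ) (j : ℕ) : Finset ℤ :=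
  (F (n j)).filter (· ∈ Z j)

lemma coe_trace (n : ℕ → ℕ) (j : ℕ) : (trace F Z n j : Set ℤ) = Z j ∩ F (n j) := by
  ext x
  simp [trace, and_comm]

lemma trace_subset (n : ℕ → ℕ) (j : ℕ) : trace F Z n j ⊆ F (n j) := by
  classical exact Finset.filter_subset _ _

lemma card_trace_div (n : ℕ → ℕ) (j : ℕ) :
    ((trace F Z n j).card : ℝ) / (F (n j)).card = dens F (Z j) (n j) := by
  rw [dens, ← Set.ncard_coe_finset, coe_trace]

lemma dens_trace (hF : IsFolnerSeq F) (n : ℕ → ℕ) (S : Set ℤ) (j : ℕ) :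
    dens (trace F Z n) S j = dens F (S ∩ Z j) (n j) / dens F (Z j) (n j) := by
  have : ((F (n j)).card : ℝ) ≠ 0 := by exact_mod_cast (hF.1 _).card_pos.ne'
  rw [← card_trace_div, dens, dens, div_div_div_cancel_right₀ this, coe_trace, Set.inter_assoc]

lemma isFolnerSeq_trace (hF : IsFolnerSeq F) {n : ℕ → ℕ} (hn : StrictMono n)
    (hZ : ∀ M, Z (M + 1) ⊆ Z M) (hZ' : ∀ M, Z (M + 1) ⊆ tr (-1) (Z M))
    (hpos : ∀ j, 0 < dens F (Z j) (n j)) {z : ℝ} (hz : 0 < z)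
    (h0 : Tendsto (fun j => dens F (Z j) (n j)) atTop (nhds z))
    (h1 : Tendsto (fun j => dens F (Z (j + 1)) (n j)) atTop (nhds z)) :
    IsFolnerSeq (trace F Z n) := by
  refine isFolnerSeq_of_one (fun j => ?_) ?_
  · rw [← Finset.card_pos, Nat.pos_iff_ne_zero]
    intro h
    have := hpos j
    rw [← card_trace_div, h] at this
    simp at this
  have hlim := (((hF.2 1).comp hn.tendsto_atTop).add (h0.sub h1)).const_mul 2 |>.div h0 hz.ne'
  rw [sub_self, add_zero, mul_zero, zero_div] at hlim
  refine squeeze_zero (fun j => by positivity) (fun j => ?_) hlim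
  have hc : (0 : ℝ) < (F (n j)).card := by exact_mod_cast (hF.1 _).card_pos
  simp only [Pi.div_apply, Function.comp_apply]
  nth_rewrite 2 [← card_trace_div]
  rw [div_div_eq_mul_div]
  refine div_le_div_of_nonneg_right ?_ (by positivity)
  rw [add_singleton_eq_tr, dens, dens, ← sub_div, ← add_div, ← mul_div_assoc,
    div_mul_cancel₀ _ hc.ne']
  set G : Set ℤ := (F (n j) : Set ℤ) with hG
  have hGf : G.Finite := (F (n j)).finite_toSet
  set Ψ : Set ℤ := (trace F Z n j : Set ℤ) with hΨ
  have hΨf : Ψ.Finite := (trace F Z n j).finite_toSet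
  have hΨe : Ψ = Z j ∩ G := coe_trace n j
  have e1 : (symmDiff Ψ (tr 1 Ψ)).ncard = 2 * (tr 1 Ψ \ Ψ).ncard := by
    have h2 := (Set.ncard_eq_ncard_iff_ncard_sdiff_eq_ncard_sdiff hΨf (finite_tr hΨf 1)).1
      (ncard_tr 1 Ψ).symm
    rw [Set.symmDiff_def, Set.ncard_union_eq (disjoint_sdiff_sdiff) hΨf.sdiff
      (finite_tr hΨf 1).sdiff]
    omega
  have e2 : (tr 1 Ψ \ Ψ).ncard ≤
      (symmDiff G (tr 1 G)).ncard + ((Z j ∩ G) \ (Z (j + 1) ∩ G)).ncard := by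
    rw [← ncard_tr 1 ((Z j ∩ G) \ (Z (j + 1) ∩ G)), hΨe]
    refine (Set.ncard_le_ncard ?_ ((hGf.symmDiff (finite_tr hGf 1)).union
      (finite_tr ((hGf.inter_of_right _).sdiff) 1))).trans (Set.ncard_union_le _ _)
    rintro x ⟨⟨hxZ, hxG⟩, hx⟩
    by_cases hxG' : x ∈ G
    · refine Or.inr ⟨⟨hxZ, hxG⟩, fun hx1 => hx ⟨?_, hxG'⟩⟩
      simpa using hZ' j hx1.1
    · exact Or.inl (Or.inr ⟨hxG, hxG'⟩)
  have e3 := Set.ncard_sdiff_add_ncard_of_subset (Set.inter_subset_inter_left G (hZ j))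
    (hGf.inter_of_right _)
  rw [e1]
  rify at e2 e3
  push_cast
  linarith

end Trace

theorem kneser_folner_Z (A B : Set ℤ) (hA : A.Nonempty) (hB : B.Nonempty) :
    ∃ k : ℕ, 0 < k ∧
      ∀ F : ℕ → Finset ℤ, IsFolnerSeq F →
        ∀ δ : ℝ,
          δ = liminf (dens F A) atTop + liminf (dens F B) atTop
              - liminf (dens F (A + B)) atTop →
          0 < δ →
          ∃ n : ℕ → ℕ, StrictMono n ∧
            ∃ Ψ : ℕ → Finset ℤ, (∀ j, Ψ j ⊆ F (n j)) ∧ IsFolnerSeq Ψ ∧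
              (k : ℝ) * δ ≤ liminf (fun j => ((Ψ j).card : ℝ) / ((F (n j)).card : ℝ)) atTop ∧
              (∃ d : ℝ, Tendsto (dens Ψ (A + B)) atTop (nhds d) ∧
                Tendsto (dens Ψ (A + B + (AddSubgroup.zmultiples (k : ℤ) : Set ℤ)))
                  atTop (nhds d)) ∧
              (∃ dA dB dAB : ℝ, Tendsto (dens Ψ A) atTop (nhds dA) ∧
                Tendsto (dens Ψ B) atTop (nhds dB) ∧
                Tendsto (dens Ψ (A + B)) atTop (nhds dAB) ∧
                δ ≤ dA + dB - dAB) := by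
  obtain ⟨k, hk, hkZ⟩ := exists_le_core hA hB
  refine ⟨k, hk, fun F hF δ hδ hδ0 => ?_⟩
  obtain ⟨U, m, hU, h, h1, hm, hmC⟩ := exists_mean hF (A + B)
  set P : Set ℤ := A + B + (AddSubgroup.zmultiples (k : ℤ) : Set ℤ) with hP
  set Z := core (A + B) P with hZdef
  have hCP : A + B ⊆ P := fun c hc =>
    Set.mem_add.2 ⟨c, hc, 0, AddSubgroup.zero_mem _, add_zero c⟩
  have hZ : Antitone Z := fun M N hMN x hx i hi => hx i (hi.trans_le hMN)
  have hZ' : ∀ M, Z (M + 1) ⊆ tr (-1) (Z M) := fun M x hx i hi hiP => by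
    have := hx (i + 1) (by omega)
    push_cast at this
    rw [sub_neg_eq_add, add_assoc, add_comm 1] at hiP ⊢
    exact this hiP
  obtain ⟨μ, hμ, hμδ, hμk⟩ := h.exists_limit_le hZ hZ' hk hkZ
  have hmδ : δ ≤ m A + m B - m (A + B) := by
    have := liminf_dens_le hU (hm A)
    have := liminf_dens_le hU (hm B)
    linarith
  have hkδ : 0 < k * δ := by positivity
  have hkδ' : k * δ ≤ k * (m A + m B - m (A + B)) := by gcongr
  have hz : 0 < μ Set.univ := by linarith
  have hμu : Tendsto (fun M => m (Z M)) atTop (nhds (μ Set.univ)) := by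
    simpa only [Set.univ_inter] using hμ Set.univ
  have hz1 : μ Set.univ ≤ 1 := le_of_tendsto' hμu fun M => h1 ▸ h.mono (Set.subset_univ _)
  obtain ⟨n, hn, hpos, hlim⟩ := exists_diagonal hU hm
    (fun j => (hkδ.trans_le hkδ').trans_le (hkZ m h j))
    (s := {(Z, μ Set.univ), (fun j => Z (j + 1), μ Set.univ), (fun j => A ∩ Z j, μ A),
      (fun j => B ∩ Z j, μ B), (fun j => (A + B) ∩ Z j, μ (A + B))}) (Set.toFinite _) (by
        simp only [Set.mem_insert_iff, Set.mem_singleton_iff, forall_eq_or_imp, forall_eq]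
        exact ⟨hμu, hμu.comp (tendsto_add_atTop_nat 1), hμ A, hμ B, hμ (A + B)⟩)
  simp only [Set.mem_insert_iff, Set.mem_singleton_iff, forall_eq_or_imp, forall_eq] at hlim
  obtain ⟨l0, l1, lA, lB, lC⟩ := hlim
  have hdens : ∀ S y, Tendsto (fun j => dens F (S ∩ Z j) (n j)) atTop (nhds y) →
      Tendsto (dens (trace F Z n) S) atTop (nhds (y / μ Set.univ)) := fun S y hS =>
    (hS.div l0 hz.ne').congr fun j => (dens_trace hF n S j).symm
  refine ⟨n, hn, trace F Z n, trace_subset n,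
    isFolnerSeq_trace hF hn (fun M => hZ M.le_succ) hZ' hpos hz l0 l1, ?_,
    ⟨_, hdens _ _ lC, (hdens _ _ lC).congr' ?_⟩, _, _, _, hdens _ _ lA, hdens _ _ lB,
    hdens _ _ lC, ?_⟩
  · simp only [card_trace_div]
    rw [l0.liminf_eq]
    exact hkδ'.trans hμk
  · filter_upwards [eventually_gt_atTop 0] with j hj
    rw [dens_trace hF, dens_trace hF]
    congr 2
    ext x
    refine ⟨fun hx => ⟨hCP hx.1, hx.2⟩, fun hx => ⟨?_, hx.2⟩⟩
    simpa using hx.2 0 hj (by simpa using hx.1)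
  · rw [← add_div, ← sub_div, le_div_iff₀ hz]
    nlinarith

end SumsetMeans
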